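/- Suppose m distinct points x_1,…,x_m ∈ ℝ^s and Y = [y_j^k] ∈ ℝ^{t×m} are given, λ > 0, and the loss function Q : ℝ^{t×m} → [0,∞) is lower semi-continuous and convex. Then every nonzero extreme point f̂ of the solution set R_{X,Y} of the regularization problem inf{Q(I_X(f_μ) − Y) + λ‖f_μ‖_{B_N} : f_μ ∈ B_N} has the form f̂(x) = Σ_{ℓ=1}^{tm} γ_ℓ h_ℓ(x) for all x ∈ ℝ^s, for some nonzero ĝ ∈ V_N, some γ_1,…,γ_{tm} ∈ ℝ with Σ_{ℓ=1}^{tm} γ_ℓ = ‖ĝ‖_∞, and some h_1,…,h_{tm} ∈ ext(∂‖·‖_∞(ĝ)). -/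

import Mathlib

open MeasureTheory Filter Topology
open scoped ZeroAtInfty BigOperators

noncomputable section

/-- The parameter space of a depth-`D` deep neural network with layer widths
`m 0, m 1, …, m D` (input dimension `m 0 = s`, output dimension `m D = t`). -/
abbrev Params (m : ℕ → ℕ) (D : ℕ) : Type :=
  (j : Fin D) → ((Fin (m (j.1 + 1)) → Fin (m j.1) → ℝ) × (Fin (m (j.1 + 1)) → ℝ))

/-- The deep neural network `N(x, θ)` of depth `D`, defined recursively by
`N¹(x) = W₁ x + b₁` and `N^{j+1}(x) = W_{j+1} σ(N^j(x)) + b_{j+1}`. -/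
def NNet (σ : ℝ → ℝ) (m : ℕ → ℕ) :
    (D : ℕ) → Params m D → (Fin (m 0) → ℝ) → Fin (m D) → ℝ
  | 0, _, x => x
  | 1, θ, x => fun i => (∑ k, (θ ⟨0, Nat.one_pos⟩).1 i k * x k) + (θ ⟨0, Nat.one_pos⟩).2 i
  | (D + 2), θ, x => fun i =>
      (∑ k, (θ (Fin.last (D + 1))).1 i k *
          σ (NNet σ m (D + 1) (fun j => θ j.castSucc) x k))
        + (θ (Fin.last (D + 1))).2 i

/-- The integral of a function against a finite signed (Radon) measure,
via the Jordan decomposition. -/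
def sInt {Θ : Type*} [MeasurableSpace Θ] (μ : SignedMeasure Θ) (f : Θ → ℝ) : ℝ :=
  (∫ θ, f θ ∂μ.toJordanDecomposition.posPart) - ∫ θ, f θ ∂μ.toJordanDecomposition.negPart

/-- The total variation norm of a signed measure. -/
def tvNorm {Θ : Type*} [MeasurableSpace Θ] (μ : SignedMeasure Θ) : ℝ :=
  (μ.totalVariation Set.univ).toReal

/-- `f_μ^k(x) := ∫_Θ N_k(x,θ) ρ(θ) dμ(θ)`. -/
def fMu (σ : ℝ → ℝ) (m : ℕ → ℕ) (D : ℕ) (ρ : Params m D → ℝ)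
    (μ : SignedMeasure (Params m D)) : (Fin (m 0) → ℝ) → Fin (m D) → ℝ :=
  fun x k => sInt μ fun θ => NNet σ m D θ x k * ρ θ

/-- The set `B_N = {f_μ : μ ∈ M(Θ)}`. -/
def BNset (σ : ℝ → ℝ) (m : ℕ → ℕ) (D : ℕ) (ρ : Params m D → ℝ) :
    Set ((Fin (m 0) → ℝ) → Fin (m D) → ℝ) :=
  {f | ∃ μ : SignedMeasure (Params m D), fMu σ m D ρ μ = f}

/-- The norm `‖f‖_{B_N} = inf {‖ν‖_TV : f_ν = f}`. -/
def BNnorm (σ : ℝ → ℝ) (m : ℕ → ℕ) (D : ℕ) (ρ : Params m D → ℝ)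
    (f : (Fin (m 0) → ℝ) → Fin (m D) → ℝ) : ℝ :=
  sInf (tvNorm '' {ν : SignedMeasure (Params m D) | fMu σ m D ρ ν = f})

/-- `S`: the closed linear span in `C₀(Θ)` of the functions `θ ↦ N_k(x,θ)ρ(θ)`
(given here as the bundled family `Kb`). -/
def Sspan (m : ℕ → ℕ) (D : ℕ)
    (Kb : (Fin (m 0) → ℝ) → Fin (m D) → C₀(Params m D, ℝ)) :
    Submodule ℝ C₀(Params m D, ℝ) :=
  (Submodule.span ℝ
    (Set.range fun p : (Fin (m 0) → ℝ) × Fin (m D) => Kb p.1 p.2)).topologicalClosure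

/-- `V_N := span {K_k(x_j, ·) : j, k}`. -/
def VN (m : ℕ → ℕ) (D : ℕ)
    (Kb : (Fin (m 0) → ℝ) → Fin (m D) → C₀(Params m D, ℝ))
    (M : ℕ) (x : Fin M → (Fin (m 0) → ℝ)) : Submodule ℝ C₀(Params m D, ℝ) :=
  Submodule.span ℝ (Set.range fun p : Fin (m D) × Fin M => Kb (x p.2) p.1)

/-- The interpolation condition `f(x_j) = y_j`, i.e. `f_k(x_j) = y_j^k` for all `j, k`. -/
def interpolates (m : ℕ → ℕ) (D : ℕ) (M : ℕ) (x : Fin M → (Fin (m 0) → ℝ))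
    (Y : Fin (m D) → Fin M → ℝ) (f : (Fin (m 0) → ℝ) → Fin (m D) → ℝ) : Prop :=
  ∀ (j : Fin M) (k : Fin (m D)), f (x j) k = Y k j

/-- The solution set `S_{X,Y}` of the MNI problem
`inf {‖f‖_{B_N} : f ∈ B_N, f(x_j) = y_j}`. -/
def MNISolSet (σ : ℝ → ℝ) (m : ℕ → ℕ) (D : ℕ) (ρ : Params m D → ℝ)
    (M : ℕ) (x : Fin M → (Fin (m 0) → ℝ)) (Y : Fin (m D) → Fin M → ℝ) :
    Set ((Fin (m 0) → ℝ) → Fin (m D) → ℝ) :=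
  {f | f ∈ BNset σ m D ρ ∧ interpolates m D M x Y f ∧
    ∀ μ : SignedMeasure (Params m D), interpolates m D M x Y (fMu σ m D ρ μ) →
      BNnorm σ m D ρ f ≤ BNnorm σ m D ρ (fMu σ m D ρ μ)}

/-- The solution set of the measure MNI problem
`inf {‖μ‖_TV : μ ∈ M(Θ), ∫ K_k(x_j,·) dμ = y_j^k}`. -/
def MeasSolSet (σ : ℝ → ℝ) (m : ℕ → ℕ) (D : ℕ) (ρ : Params m D → ℝ)
    (M : ℕ) (x : Fin M → (Fin (m 0) → ℝ)) (Y : Fin (m D) → Fin M → ℝ) :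
    Set (SignedMeasure (Params m D)) :=
  {μ | interpolates m D M x Y (fMu σ m D ρ μ) ∧
    ∀ ν : SignedMeasure (Params m D), interpolates m D M x Y (fMu σ m D ρ ν) →
      tvNorm μ ≤ tvNorm ν}

/-- The subdifferential `∂‖·‖_∞(g) ⊆ B_N` of the supremum norm at `g ∈ S`, viewing `B_N`
as the dual of `S` via the (representation independent) pairing `⟨f_μ, g⟩ = ∫ g dμ`:
`∂‖·‖_∞(g) = {f_μ ∈ B_N : ‖f_μ‖_{B_N} = 1, ∫ g dμ = ‖g‖_∞}`. -/
def subdiffSup (σ : ℝ → ℝ) (m : ℕ → ℕ) (D : ℕ) (ρ : Params m D → ℝ)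
    (g : C₀(Params m D, ℝ)) : Set ((Fin (m 0) → ℝ) → Fin (m D) → ℝ) :=
  {f | f ∈ BNset σ m D ρ ∧ BNnorm σ m D ρ f = 1 ∧
    ∀ μ : SignedMeasure (Params m D), fMu σ m D ρ μ = f → sInt μ (fun θ => g θ) = ‖g‖}

/-- Feasibility for the dual problem: `‖∑_{k,j} c_{kj} K_k(x_j,·)‖_∞ = 1`. -/
def dualFeasible (m : ℕ → ℕ) (D : ℕ)
    (Kb : (Fin (m 0) → ℝ) → Fin (m D) → C₀(Params m D, ℝ))
    (M : ℕ) (x : Fin M → (Fin (m 0) → ℝ)) (c : Fin (m D) → Fin M → ℝ) : Prop :=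
  ‖∑ k, ∑ j, c k j • Kb (x j) k‖ = 1

/-- The objective `∑_{k,j} c_{kj} y_j^k` of the dual problem. -/
def dualObjective (m : ℕ → ℕ) (D : ℕ) (M : ℕ) (Y : Fin (m D) → Fin M → ℝ)
    (c : Fin (m D) → Fin M → ℝ) : ℝ :=
  ∑ k, ∑ j, c k j * Y k j

/-- `c` is a solution of the dual problem. -/
def dualSolves (m : ℕ → ℕ) (D : ℕ)
    (Kb : (Fin (m 0) → ℝ) → Fin (m D) → C₀(Params m D, ℝ))
    (M : ℕ) (x : Fin M → (Fin (m 0) → ℝ)) (Y : Fin (m D) → Fin M → ℝ)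
    (c : Fin (m D) → Fin M → ℝ) : Prop :=
  dualFeasible m D Kb M x c ∧
    ∀ c' : Fin (m D) → Fin M → ℝ, dualFeasible m D Kb M x c' →
      dualObjective m D M Y c' ≤ dualObjective m D M Y c

/-- `ĝ := C* · ∑_{k,j} ĉ_{kj} K_k(x_j,·)`, where `C*` is the optimal dual value
(the value of the dual objective at the dual solution `c`). -/
def ghat (m : ℕ → ℕ) (D : ℕ)
    (Kb : (Fin (m 0) → ℝ) → Fin (m D) → C₀(Params m D, ℝ))
    (M : ℕ) (x : Fin M → (Fin (m 0) → ℝ)) (Y : Fin (m D) → Fin M → ℝ)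
    (c : Fin (m D) → Fin M → ℝ) : C₀(Params m D, ℝ) :=
  dualObjective m D M Y c • ∑ k, ∑ j, c k j • Kb (x j) k

/-- `Θ(g) := {θ ∈ Θ : |g(θ)| = ‖g‖_∞}`. -/
def ThetaSet (m : ℕ → ℕ) (D : ℕ) (g : C₀(Params m D, ℝ)) : Set (Params m D) :=
  {θ | |g θ| = ‖g‖}

/-- The regularization objective `Q(I_X(f) − Y) + λ ‖f‖_{B_N}`. -/
def regObj (σ : ℝ → ℝ) (m : ℕ → ℕ) (D : ℕ) (ρ : Params m D → ℝ)
    (M : ℕ) (x : Fin M → (Fin (m 0) → ℝ)) (Y : Fin (m D) → Fin M → ℝ)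
    (lam : ℝ) (Q : (Fin (m D) → Fin M → ℝ) → ℝ)
    (f : (Fin (m 0) → ℝ) → Fin (m D) → ℝ) : ℝ :=
  Q ((fun k j => f (x j) k) - Y) + lam * BNnorm σ m D ρ f

/-- The solution set `R_{X,Y}` of the regularization problem. -/
def RegSolSet (σ : ℝ → ℝ) (m : ℕ → ℕ) (D : ℕ) (ρ : Params m D → ℝ)
    (M : ℕ) (x : Fin M → (Fin (m 0) → ℝ)) (Y : Fin (m D) → Fin M → ℝ)
    (lam : ℝ) (Q : (Fin (m D) → Fin M → ℝ) → ℝ) :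
    Set ((Fin (m 0) → ℝ) → Fin (m D) → ℝ) :=
  {f | f ∈ BNset σ m D ρ ∧
    ∀ μ : SignedMeasure (Params m D),
      regObj σ m D ρ M x Y lam Q f ≤ regObj σ m D ρ M x Y lam Q (fMu σ m D ρ μ)}

/-- `D_{X,Y} := I_X(R_{X,Y})`. -/
def DXY (σ : ℝ → ℝ) (m : ℕ → ℕ) (D : ℕ) (ρ : Params m D → ℝ)
    (M : ℕ) (x : Fin M → (Fin (m 0) → ℝ)) (Y : Fin (m D) → Fin M → ℝ)
    (lam : ℝ) (Q : (Fin (m D) → Fin M → ℝ) → ℝ) : Set (Fin (m D) → Fin M → ℝ) :=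
  (fun f => fun k j => f (x j) k) '' RegSolSet σ m D ρ M x Y lam Q

/-- A vector of minimal norm among those with prescribed values of finitely many linear
functionals is normed by a linear combination of these functionals. -/
theorem exists_norming_combination {V ι : Type*} [NormedAddCommGroup V] [NormedSpace ℝ V]
    [Fintype ι] (L : ι → V →ₗ[ℝ] ℝ) (u : V)
    (hmin : ∀ v, (∀ i, L i v = L i u) → ‖u‖ ≤ ‖v‖) :
    ∃ c : ι → ℝ, (∀ v, ∑ i, c i * L i v ≤ ‖v‖) ∧ ∑ i, c i * L i u = ‖u‖ := by
  set S : Submodule ℝ V := ⨅ i, LinearMap.ker (L i) with hS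
  obtain ⟨g, hg1, hg2⟩ := exists_dual_vector'' ℝ (S.mkQ u)
  have hgu : g (S.mkQ u) = ‖u‖ := by
    refine hg2.trans (le_antisymm (Submodule.Quotient.norm_mk_le S u) ?_)
    refine QuotientAddGroup.le_norm_iff.2 fun v hv => hmin v fun i => ?_
    have hmem : v - u ∈ S := (Submodule.Quotient.eq S).1 hv
    have := (Submodule.mem_iInf _).1 hmem i
    rwa [LinearMap.mem_ker, map_sub, sub_eq_zero] at this
  have hφ : (g : (V ⧸ S) →ₗ[ℝ] ℝ) ∘ₗ S.mkQ ∈ Submodule.span ℝ (Set.range L) := by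
    refine mem_span_of_iInf_ker_le_ker fun v hv => ?_
    have : S.mkQ v = 0 := by simpa [hS] using hv
    simp [this]
  obtain ⟨c, hc⟩ := (Submodule.mem_span_range_iff_exists_fun ℝ).1 hφ
  have hc' : ∀ v, ∑ i, c i * L i v = g (S.mkQ v) := fun v => by
    have := LinearMap.congr_fun hc v
    simpa using this
  refine ⟨c, fun v => ?_, by rw [hc', hgu]⟩
  rw [hc']
  calc g (S.mkQ v) ≤ ‖g (S.mkQ v)‖ := le_abs_self _
    _ ≤ 1 * ‖S.mkQ v‖ := g.le_of_opNorm_le hg1 _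
    _ ≤ ‖v‖ := by rw [one_mul]; exact Submodule.Quotient.norm_mk_le S v

/-- The vectors on which `φ` attains its bound `1` on the closed unit ball. -/
def normedFace {V : Type*} [NormedAddCommGroup V] [NormedSpace ℝ V] (φ : V →ₗ[ℝ] ℝ) : Set V :=
  {v | ‖v‖ ≤ 1 ∧ φ v = 1}

section Face

variable {V : Type*} [NormedAddCommGroup V] [NormedSpace ℝ V] {φ : V →ₗ[ℝ] ℝ}

theorem convex_normedFace : Convex ℝ (normedFace φ) := by
  intro x hx y hy a b ha hb hab
  refine ⟨?_, by simp [hx.2, hy.2, hab]⟩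
  have := (convex_closedBall (0 : V) 1) (mem_closedBall_zero_iff.2 hx.1)
    (mem_closedBall_zero_iff.2 hy.1) ha hb hab
  simpa using this

/-- The span of the minimal face of `normedFace φ` around one of its points `u`. -/
def faceSpan (φ : V →ₗ[ℝ] ℝ) {u : V} (hu : u ∈ normedFace φ) : Submodule ℝ V where
  carrier := {z | ∃ ε > 0, ∀ s : ℝ, |s| ≤ ε → u + s • (z - φ z • u) ∈ normedFace φ}
  zero_mem' := ⟨1, one_pos, fun s _ => by simpa using hu⟩
  add_mem' := by
    rintro z w ⟨ε, hε, hz⟩ ⟨δ, hδ, hw⟩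
    refine ⟨min ε δ / 2, by positivity, fun s hs => ?_⟩
    have h2 : |2 * s| ≤ min ε δ := by rw [abs_mul, abs_two]; linarith
    have := convex_normedFace (hz (2 * s) (h2.trans (min_le_left _ _)))
      (hw (2 * s) (h2.trans (min_le_right _ _))) (a := 1 / 2) (b := 1 / 2)
      (by norm_num) (by norm_num) (by norm_num)
    convert this using 1
    rw [map_add]
    module
  smul_mem' := by
    rintro c z ⟨ε, hε, hz⟩
    refine ⟨ε / (|c| + 1), by positivity, fun s hs => ?_⟩
    have hsc : |s * c| ≤ ε := by
      rw [le_div_iff₀ (by positivity)] at hs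
      rw [abs_mul]
      nlinarith [abs_nonneg s]
    convert hz (s * c) hsc using 1
    rw [map_smul, smul_eq_mul]
    module

theorem mem_faceSpan_self {u : V} (hu : u ∈ normedFace φ) : u ∈ faceSpan φ hu :=
  ⟨1, one_pos, fun s _ => by simpa [hu.2] using hu⟩

theorem isExtreme_faceSpan {u : V} (hu : u ∈ normedFace φ) :
    IsExtreme ℝ (normedFace φ) (normedFace φ ∩ faceSpan φ hu) := by
  refine ⟨Set.inter_subset_left, ?_⟩
  rintro x hx y hy e ⟨he, ε, hε, hmem⟩ ⟨a, b, ha, hb, hab, rfl⟩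
  refine ⟨hx, ?_⟩
  have hz := hmem (-ε) (by rw [abs_neg, abs_of_pos hε])
  rw [he.2, one_smul] at hz
  set z := u + (-ε) • (a • x + b • y - u) with hzdef
  set α := ε * a / (1 + ε) with hα
  have h1 : (0 : ℝ) < 1 + ε := by positivity
  have hα0 : 0 < α := by positivity
  refine ⟨α, hα0, fun s hs => ?_⟩
  obtain ⟨hs1, hs2⟩ := abs_le.1 hs
  have hα1 : α ≤ 1 := by
    rw [hα, div_le_one h1]
    nlinarith
  rw [hx.2, one_smul]
  have hc : ∀ p q r : ℝ, 0 ≤ p → 0 ≤ q → 0 ≤ r → p + q + r = 1 →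
      p • x + q • y + r • z ∈ normedFace φ := fun p q r hp hq hr h => by
    have := convex_normedFace.sum_mem (t := Finset.univ) (w := ![p, q, r]) (z := ![x, y, z])
      (by intro i _; fin_cases i <;> assumption) (by simp [Fin.sum_univ_three, h])
      (by intro i _; fin_cases i <;> assumption)
    simpa [Fin.sum_univ_three] using this
  have hu' : u = α • x + (ε * b / (1 + ε)) • y + (1 / (1 + ε)) • z := by
    rw [hzdef, hα]
    match_scalars <;> field_simp <;> ring
  have := hc (s + (1 - s) * α) ((1 - s) * (ε * b / (1 + ε))) ((1 - s) * (1 / (1 + ε)))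
    (by nlinarith) (mul_nonneg (by linarith) (by positivity))
    (mul_nonneg (by linarith) (by positivity))
    (by
      rw [hα]
      field_simp
      have : b = 1 - a := by linarith
      subst this
      ring)
  convert this using 1
  calc u + s • (x - u) = s • x + (1 - s) • u := by module
    _ = s • x + (1 - s) • (α • x + (ε * b / (1 + ε)) • y + (1 / (1 + ε)) • z) := by rw [← hu']
    _ = _ := by module

theorem mem_span_extremePoints_normedFace (hφ : ∀ v, φ v ≤ ‖v‖) {u : V}
    (hu : u ∈ normedFace φ) [FiniteDimensional ℝ (faceSpan φ hu)] :
    u ∈ Submodule.span ℝ ((normedFace φ).extremePoints ℝ ∩ faceSpan φ hu) := by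
  set U := faceSpan φ hu
  set K := normedFace φ ∩ U with hK
  have hφc : Continuous φ := by
    refine AddMonoidHomClass.continuous_of_bound φ 1 fun v => ?_
    rw [one_mul, Real.norm_eq_abs, abs_le]
    refine ⟨?_, hφ v⟩
    have := hφ (-v)
    rw [map_neg, norm_neg] at this
    linarith
  have hclosed : IsClosed (normedFace φ) :=
    (isClosed_le continuous_norm continuous_const).inter (isClosed_eq hφc continuous_const)
  have hcomp : IsCompact K := by
    have hpre : IsCompact ((↑) ⁻¹' (normedFace φ) : Set U) := by
      refine Metric.isCompact_of_isClosed_isBounded (hclosed.preimage continuous_subtype_val) ?_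
      refine (Metric.isBounded_closedBall (x := (0 : U)) (r := 1)).subset fun v hv => ?_
      simpa using hv.1
    have himage : Subtype.val '' ((↑) ⁻¹' (normedFace φ) : Set U) = K := by
      ext v
      simp [hK, and_comm]
    exact himage ▸ hpre.image continuous_subtype_val
  have hconv : Convex ℝ K := convex_normedFace.inter U.convex
  have hKu : u ∈ K := ⟨hu, mem_faceSpan_self hu⟩
  rw [← closure_convexHull_extremePoints hcomp hconv] at hKu
  have hsub : K.extremePoints ℝ ⊆ (normedFace φ).extremePoints ℝ ∩ U := fun e he =>
    ⟨(isExtreme_faceSpan hu).extremePoints_subset_extremePoints he, he.1.2⟩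
  set T := Submodule.span ℝ ((normedFace φ).extremePoints ℝ ∩ (U : Set V))
  have hTU : T ≤ U := Submodule.span_le.2 Set.inter_subset_right
  have : FiniteDimensional ℝ T := Submodule.finiteDimensional_of_le hTU
  exact closure_minimal (convexHull_min (hsub.trans Submodule.subset_span) T.convex)
    T.closed_of_finiteDimensional hKu

end Face

/-- If a linear functional `φ` bounded by the norm is a combination of the functionals `L i`, an
extreme point of a slice of the face `{φ = 1}` of the unit ball by the `L i` is a combination of
as many extreme points of the face as there are functionals. -/
theorem exists_combination_extremePoints {V : Type*} [NormedAddCommGroup V] [NormedSpace ℝ V]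
    {n : ℕ} (L : Fin n → V →ₗ[ℝ] ℝ) (c : Fin n → ℝ) (φ : V →ₗ[ℝ] ℝ)
    (hφL : ∀ v, φ v = ∑ i, c i * L i v) (hφ : ∀ v, φ v ≤ ‖v‖) {u : V}
    (hu : u ∈ (normedFace φ ∩ {v | ∀ i, L i v = L i u}).extremePoints ℝ) :
    ∃ (γ : Fin n → ℝ) (h : Fin n → V), ∑ i, γ i = 1 ∧
      (∀ i, h i ∈ (normedFace φ).extremePoints ℝ) ∧ u = ∑ i, γ i • h i := by
  have huF := hu.1.1
  set U := faceSpan φ huF with hU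
  have hinj : Function.Injective (LinearMap.pi L ∘ₗ U.subtype) := by
    refine (injective_iff_map_eq_zero _).2 ?_
    rintro ⟨z, ε, hε, hz⟩ hLz
    have hLz' : ∀ i, L i z = 0 := fun i => congrFun hLz i
    have hφz : φ z = 0 := by simp [hφL, hLz']
    have hmem : ∀ s : ℝ, |s| ≤ ε → u + s • z ∈ normedFace φ ∩ {v | ∀ i, L i v = L i u} :=
      fun s hs => ⟨by simpa [hφz] using hz s hs, fun i => by simp [hLz']⟩
    have hp := hmem ε (abs_of_pos hε).le
    have hm := hmem (-ε) (by rw [abs_neg, abs_of_pos hε])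
    have := hu.2 hp hm ⟨1 / 2, 1 / 2, by norm_num, by norm_num, by norm_num, by module⟩
    have hz0 : z = 0 := by simpa [hε.ne'] using this
    exact Subtype.ext hz0
  have : FiniteDimensional ℝ U := FiniteDimensional.of_injective _ hinj
  have hdim : Module.finrank ℝ U ≤ n := by
    simpa using LinearMap.finrank_le_finrank_of_injective hinj
  have huspan := mem_span_extremePoints_normedFace hφ huF
  obtain ⟨t, htsub, htspan, htind⟩ :=
    exists_linearIndependent ℝ ((normedFace φ).extremePoints ℝ ∩ (U : Set V))
  rw [← htspan] at huspan
  have htU : t ⊆ U := htsub.trans Set.inter_subset_right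
  have htindU : LinearIndependent ℝ (fun a : t => (⟨a.1, htU a.2⟩ : U)) :=
    LinearIndependent.of_comp U.subtype htind
  have : Finite t := htindU.finite
  have := Fintype.ofFinite t
  have hcard : Fintype.card t ≤ Fintype.card (Fin n) := by
    simpa using htindU.fintype_card_le_finrank.trans hdim
  obtain ⟨j⟩ := Function.Embedding.nonempty_of_card_le hcard
  have hspan' : u ∈ Submodule.span ℝ (Set.range ((↑) : t → V)) := by simpa using huspan
  obtain ⟨w, hw⟩ := (Submodule.mem_span_range_iff_exists_fun ℝ).1 hspan'
  have hne : Nonempty t := by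
    by_contra hcon
    rw [not_nonempty_iff] at hcon
    have h0 : u = 0 := by rw [← hw]; simp
    have := huF.2
    simp [h0] at this
  obtain ⟨e⟩ := hne
  let γ : Fin n → ℝ := Function.extend j w 0
  let h : Fin n → V := Function.extend j (↑) (fun _ => (e : V))
  have hext : ∀ i, h i ∈ (normedFace φ).extremePoints ℝ := fun i => by
    by_cases hi : ∃ a, j a = i
    · obtain ⟨a, rfl⟩ := hi
      simpa [h, j.injective.extend_apply] using (htsub a.2).1
    · simpa [h, Function.extend_apply' _ _ _ hi] using (htsub e.2).1
  have hsum : u = ∑ i, γ i • h i := by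
    rw [← hw]
    refine Finset.sum_of_injOn j j.injective.injOn (by simp) (fun i _ hi => ?_) fun a _ => ?_
    · have : ¬ ∃ a, j a = i := by simpa using hi
      simp [γ, Function.extend_apply' _ _ _ this]
    · simp [γ, h, j.injective.extend_apply]
  refine ⟨γ, h, ?_, hext, hsum⟩
  have h1 : φ u = 1 := huF.2
  rw [hsum, map_sum] at h1
  simpa [(hext _).1.2] using h1

/-- A minimal-norm vector `f` that is extreme among the minimal-norm vectors with the same values
of finitely many linear functionals is a combination of as many extreme points of the face of the
unit ball cut out by a combination of these functionals which is norming for `f`. -/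
theorem exists_combination_of_minimal_extreme {V : Type*} [NormedAddCommGroup V]
    [NormedSpace ℝ V] {n : ℕ} (L : Fin n → V →ₗ[ℝ] ℝ) {f : V} (hf : f ≠ 0)
    (hmin : ∀ v, (∀ i, L i v = L i f) → ‖f‖ ≤ ‖v‖)
    (hext : f ∈ ({v | ‖v‖ ≤ ‖f‖ ∧ ∀ i, L i v = L i f}).extremePoints ℝ) :
    ∃ c : Fin n → ℝ, (∀ v, ∑ i, c i * L i v ≤ ‖v‖) ∧ ∑ i, c i * L i f = ‖f‖ ∧
      ∃ (γ : Fin n → ℝ) (h : Fin n → V), ∑ i, γ i = ‖f‖ ∧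
        (∀ i, h i ∈ ({v | ‖v‖ ≤ 1 ∧ ∑ j, c j * L j v = 1}).extremePoints ℝ) ∧
        f = ∑ i, γ i • h i := by
  obtain ⟨c, hc, hcf⟩ := exists_norming_combination L f hmin
  refine ⟨c, hc, hcf, ?_⟩
  have hr : 0 < ‖f‖ := norm_pos_iff.2 hf
  let φ : V →ₗ[ℝ] ℝ := ∑ i, c i • L i
  have hφL : ∀ v, φ v = ∑ i, c i * L i v := fun v => by simp [φ]
  have hface : normedFace φ = {v | ‖v‖ ≤ 1 ∧ ∑ j, c j * L j v = 1} := by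
    ext v
    simp [normedFace, hφL]
  have hu : ‖f‖⁻¹ • f ∈
      (normedFace φ ∩ {v | ∀ i, L i v = L i (‖f‖⁻¹ • f)}).extremePoints ℝ := by
    refine ⟨⟨⟨?_, ?_⟩, fun _ => rfl⟩, ?_⟩
    · rw [norm_smul, norm_inv, norm_norm, inv_mul_cancel₀ hr.ne']
    · rw [map_smul, hφL, hcf, smul_eq_mul, inv_mul_cancel₀ hr.ne']
    · have hmem : ∀ v ∈ normedFace φ ∩ {v | ∀ i, L i v = L i (‖f‖⁻¹ • f)},
          ‖f‖ • v ∈ {v | ‖v‖ ≤ ‖f‖ ∧ ∀ i, L i v = L i f} := by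
        rintro v ⟨⟨hv, -⟩, hvL⟩
        refine ⟨?_, fun i => ?_⟩
        · rw [norm_smul, norm_norm]
          exact mul_le_of_le_one_right hr.le hv
        · rw [map_smul, hvL i, map_smul, smul_smul, mul_inv_cancel₀ hr.ne', one_smul]
      rintro v hv w hw ⟨a, b, ha, hb, hab, hvw⟩
      have := hext.2 (hmem v hv) (hmem w hw) ⟨a, b, ha, hb, hab, by
        rw [smul_comm a, smul_comm b, ← smul_add, hvw, smul_smul, mul_inv_cancel₀ hr.ne',
          one_smul]⟩
      exact (eq_inv_smul_iff₀ hr.ne').2 this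
  obtain ⟨γ, h, hγ, hh, hsum⟩ := exists_combination_extremePoints L c φ hφL
    (fun v => (hφL v).trans_le (hc v)) hu
  refine ⟨fun i => ‖f‖ * γ i, h, ?_, fun i => hface ▸ hh i, ?_⟩
  · rw [← Finset.mul_sum, hγ, mul_one]
  · simp_rw [mul_smul]
    rw [← Finset.smul_sum, ← hsum, smul_smul, mul_inv_cancel₀ hr.ne', one_smul]

/-- `exists_combination_of_minimal_extreme` for a norm given as a definite seminorm. -/
theorem Seminorm.exists_combination_of_minimal_extreme {V : Type*} [AddCommGroup V]
    [Module ℝ V] (p : Seminorm ℝ V) (hp : ∀ v, p v = 0 → v = 0) {n : ℕ}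
    (L : Fin n → V →ₗ[ℝ] ℝ) {f : V} (hf : f ≠ 0)
    (hmin : ∀ v, (∀ i, L i v = L i f) → p f ≤ p v)
    (hext : f ∈ ({v | p v ≤ p f ∧ ∀ i, L i v = L i f}).extremePoints ℝ) :
    ∃ c : Fin n → ℝ, (∀ v, ∑ i, c i * L i v ≤ p v) ∧ ∑ i, c i * L i f = p f ∧
      ∃ (γ : Fin n → ℝ) (h : Fin n → V), ∑ i, γ i = p f ∧
        (∀ i, h i ∈ ({v | p v ≤ 1 ∧ ∑ j, c j * L j v = 1}).extremePoints ℝ) ∧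
        f = ∑ i, γ i • h i := by
  let : Norm V := ⟨p⟩
  have core : NormedSpace.Core ℝ V :=
    { norm_nonneg := apply_nonneg p
      norm_smul := map_smul_eq_mul p
      norm_triangle := map_add_le_add p
      norm_eq_zero_iff := fun v => ⟨hp v, fun h => h ▸ map_zero p⟩ }
  let : NormedAddCommGroup V := NormedAddCommGroup.ofCore core
  let : NormedSpace ℝ V := NormedSpace.ofCore core
  exact _root_.exists_combination_of_minimal_extreme L hf hmin hext

section SignedMeasure

variable {Θ : Type*} [MeasurableSpace Θ]

theorem tvNorm_nonneg (μ : SignedMeasure Θ) : 0 ≤ tvNorm μ := ENNReal.toReal_nonneg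

theorem tvNorm_eq (μ : SignedMeasure Θ) :
    tvNorm μ = μ.toJordanDecomposition.posPart.real Set.univ +
      μ.toJordanDecomposition.negPart.real Set.univ := by
  rw [tvNorm, SignedMeasure.totalVariation, ← measureReal_add_apply, measureReal_def]

theorem tvNorm_toSignedMeasure_sub_le (a b : Measure Θ) [IsFiniteMeasure a] [IsFiniteMeasure b] :
    tvNorm (a.toSignedMeasure - b.toSignedMeasure) ≤ a.real Set.univ + b.real Set.univ := by
  set μ := a.toSignedMeasure - b.toSignedMeasure with hμ
  obtain ⟨i, hi, hi₁, hi₂, hp, hn⟩ := μ.toJordanDecomposition_spec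
  rw [tvNorm_eq, hp, hn]
  have h1 := SignedMeasure.toMeasureOfZeroLE_real_apply μ hi₁ hi MeasurableSet.univ
  have h2 := SignedMeasure.toMeasureOfLEZero_real_apply μ hi₂ hi.compl MeasurableSet.univ
  rw [Set.inter_univ] at h1 h2
  rw [h1, h2, hμ, Measure.toSignedMeasure_sub_apply hi, Measure.toSignedMeasure_sub_apply hi.compl]
  have h3 : a.real i ≤ a.real Set.univ := measureReal_mono (Set.subset_univ _)
  have h4 : b.real iᶜ ≤ b.real Set.univ := measureReal_mono (Set.subset_univ _)
  have h5 : 0 ≤ a.real iᶜ := measureReal_nonneg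
  have h6 : 0 ≤ b.real i := measureReal_nonneg
  linarith

theorem jordan_sub (μ : SignedMeasure Θ) :
    μ = μ.toJordanDecomposition.posPart.toSignedMeasure -
      μ.toJordanDecomposition.negPart.toSignedMeasure :=
  μ.toSignedMeasure_toJordanDecomposition.symm

theorem tvNorm_add_le (μ ν : SignedMeasure Θ) : tvNorm (μ + ν) ≤ tvNorm μ + tvNorm ν := by
  have h : μ + ν = (μ.toJordanDecomposition.posPart +
      ν.toJordanDecomposition.posPart).toSignedMeasure - (μ.toJordanDecomposition.negPart +
      ν.toJordanDecomposition.negPart).toSignedMeasure := by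
    conv_lhs => rw [jordan_sub μ, jordan_sub ν]
    rw [Measure.toSignedMeasure_add, Measure.toSignedMeasure_add]
    abel
  rw [h]
  refine (tvNorm_toSignedMeasure_sub_le _ _).trans ?_
  rw [measureReal_add_apply, measureReal_add_apply, tvNorm_eq, tvNorm_eq]
  linarith

theorem tvNorm_smul (c : ℝ) (μ : SignedMeasure Θ) : tvNorm (c • μ) = |c| * tvNorm μ := by
  rw [tvNorm_eq, tvNorm_eq, SignedMeasure.toJordanDecomposition_smul_real]
  rcases le_or_gt 0 c with hc | hc
  · rw [JordanDecomposition.real_smul_posPart_nonneg _ _ hc,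
      JordanDecomposition.real_smul_negPart_nonneg _ _ hc, measureReal_nnreal_smul_apply,
      measureReal_nnreal_smul_apply, Real.coe_toNNReal _ hc, abs_of_nonneg hc]
    ring
  · rw [JordanDecomposition.real_smul_posPart_neg _ _ hc,
      JordanDecomposition.real_smul_negPart_neg _ _ hc, measureReal_nnreal_smul_apply,
      measureReal_nnreal_smul_apply, Real.coe_toNNReal _ (by linarith), abs_of_neg hc]
    ring

theorem tvNorm_toSignedMeasure_dirac_le (θ : Θ) : tvNorm (Measure.dirac θ).toSignedMeasure ≤ 1 := by
  have := tvNorm_toSignedMeasure_sub_le (Measure.dirac θ) 0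
  simpa using this

theorem sInt_smul_measure (c : ℝ) (μ : SignedMeasure Θ) (f : Θ → ℝ) :
    sInt (c • μ) f = c * sInt μ f := by
  rw [sInt, sInt, SignedMeasure.toJordanDecomposition_smul_real]
  rcases le_or_gt 0 c with hc | hc
  · rw [JordanDecomposition.real_smul_posPart_nonneg _ _ hc,
      JordanDecomposition.real_smul_negPart_nonneg _ _ hc, integral_smul_nnreal_measure,
      integral_smul_nnreal_measure, NNReal.smul_def, NNReal.smul_def, Real.coe_toNNReal _ hc]
    simp only [smul_eq_mul]
    ring
  · rw [JordanDecomposition.real_smul_posPart_neg _ _ hc,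
      JordanDecomposition.real_smul_negPart_neg _ _ hc, integral_smul_nnreal_measure,
      integral_smul_nnreal_measure, NNReal.smul_def, NNReal.smul_def,
      Real.coe_toNNReal _ (by linarith)]
    simp only [smul_eq_mul]
    ring

variable [TopologicalSpace Θ]

theorem abs_sInt_le (μ : SignedMeasure Θ) (g : C₀(Θ, ℝ)) : |sInt μ g| ≤ ‖g‖ * tvNorm μ := by
  have key : ∀ a : Measure Θ, IsFiniteMeasure a → |∫ θ, g θ ∂a| ≤ ‖g‖ * a.real Set.univ :=
    fun a _ => norm_integral_le_of_norm_le_const (ae_of_all _ fun θ => g.toBCF.norm_coe_le_norm θ)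
  rw [sInt, tvNorm_eq, mul_add]
  exact (abs_sub _ _).trans (add_le_add (key _ inferInstance) (key _ inferInstance))

variable [OpensMeasurableSpace Θ]

theorem integrable_zeroAtInfty (a : Measure Θ) [IsFiniteMeasure a] (g : C₀(Θ, ℝ)) :
    Integrable g a :=
  Integrable.of_bound g.continuous.measurable.aestronglyMeasurable ‖g‖
    (ae_of_all _ fun θ => g.toBCF.norm_coe_le_norm θ)

theorem sInt_toSignedMeasure_sub (a b : Measure Θ) [IsFiniteMeasure a] [IsFiniteMeasure b]
    (g : C₀(Θ, ℝ)) :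
    sInt (a.toSignedMeasure - b.toSignedMeasure) g = ∫ θ, g θ ∂a - ∫ θ, g θ ∂b := by
  set μ := a.toSignedMeasure - b.toSignedMeasure with hμ
  have h : a + μ.toJordanDecomposition.negPart = μ.toJordanDecomposition.posPart + b := by
    rw [← Measure.toSignedMeasure_eq_toSignedMeasure_iff, Measure.toSignedMeasure_add,
      Measure.toSignedMeasure_add, ← sub_eq_sub_iff_add_eq_add, ← hμ]
    exact jordan_sub μ
  have h' : ∫ θ, g θ ∂(a + μ.toJordanDecomposition.negPart) =
      ∫ θ, g θ ∂(μ.toJordanDecomposition.posPart + b) := by rw [h]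
  rw [integral_add_measure (integrable_zeroAtInfty _ g) (integrable_zeroAtInfty _ g),
    integral_add_measure (integrable_zeroAtInfty _ g) (integrable_zeroAtInfty _ g)] at h'
  rw [sInt]
  linarith

theorem sInt_add_measure (μ ν : SignedMeasure Θ) (g : C₀(Θ, ℝ)) :
    sInt (μ + ν) g = sInt μ g + sInt ν g := by
  have h : μ + ν = (μ.toJordanDecomposition.posPart +
      ν.toJordanDecomposition.posPart).toSignedMeasure - (μ.toJordanDecomposition.negPart +
      ν.toJordanDecomposition.negPart).toSignedMeasure := by
    conv_lhs => rw [jordan_sub μ, jordan_sub ν]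
    rw [Measure.toSignedMeasure_add, Measure.toSignedMeasure_add]
    abel
  rw [h, sInt_toSignedMeasure_sub,
    integral_add_measure (integrable_zeroAtInfty _ g) (integrable_zeroAtInfty _ g),
    integral_add_measure (integrable_zeroAtInfty _ g) (integrable_zeroAtInfty _ g), sInt, sInt]
  ring

theorem sInt_toSignedMeasure_dirac (θ : Θ) (g : C₀(Θ, ℝ)) :
    sInt (Measure.dirac θ).toSignedMeasure g = g θ := by
  have := sInt_toSignedMeasure_sub (Measure.dirac θ) 0 g
  rw [integral_dirac' (⇑g) _ g.continuous.measurable.stronglyMeasurable] at this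
  simpa using this

theorem sInt_sum_smul {ι : Type*} (s : Finset ι) (μ : SignedMeasure Θ) (c : ι → ℝ)
    (g : ι → C₀(Θ, ℝ)) :
    sInt μ (∑ i ∈ s, c i • g i : C₀(Θ, ℝ)) = ∑ i ∈ s, c i * sInt μ (g i) := by
  have key : ∀ a : Measure Θ, IsFiniteMeasure a →
      ∫ θ, (∑ i ∈ s, c i • g i : C₀(Θ, ℝ)) θ ∂a = ∑ i ∈ s, c i * ∫ θ, g i θ ∂a := by
    intro a _
    have : ∀ θ, (∑ i ∈ s, c i • g i : C₀(Θ, ℝ)) θ = ∑ i ∈ s, c i * g i θ := fun θ => by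
      induction s using Finset.cons_induction with
      | empty => simp
      | cons i s hi ih => simp [Finset.sum_cons, ih]
    simp_rw [this]
    rw [integral_finsetSum _ fun i _ => (integrable_zeroAtInfty a (g i)).const_mul _]
    simp_rw [integral_const_mul]
  rw [sInt, key _ inferInstance, key _ inferInstance, ← Finset.sum_sub_distrib]
  simp_rw [sInt, mul_sub]

end SignedMeasure

section Network

variable {σ : ℝ → ℝ} {m : ℕ → ℕ} {D : ℕ} {ρ : Params m D → ℝ}
  {Kb : (Fin (m 0) → ℝ) → Fin (m D) → C₀(Params m D, ℝ)}

theorem fMu_apply (hKb : ∀ x k θ, Kb x k θ = NNet σ m D θ x k * ρ θ)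
    (μ : SignedMeasure (Params m D)) (x : Fin (m 0) → ℝ) (k : Fin (m D)) :
    fMu σ m D ρ μ x k = sInt μ (Kb x k) := by
  simp only [fMu, ← hKb]

theorem fMu_add (hKb : ∀ x k θ, Kb x k θ = NNet σ m D θ x k * ρ θ)
    (μ ν : SignedMeasure (Params m D)) :
    fMu σ m D ρ (μ + ν) = fMu σ m D ρ μ + fMu σ m D ρ ν := by
  ext x k
  simp only [Pi.add_apply, fMu_apply hKb, sInt_add_measure]

theorem fMu_smul (c : ℝ) (μ : SignedMeasure (Params m D)) :
    fMu σ m D ρ (c • μ) = c • fMu σ m D ρ μ := by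
  ext x k
  simp only [Pi.smul_apply, fMu, sInt_smul_measure, smul_eq_mul]

theorem BNnorm_nonneg (f : (Fin (m 0) → ℝ) → Fin (m D) → ℝ) : 0 ≤ BNnorm σ m D ρ f :=
  Real.sInf_nonneg (by rintro _ ⟨ν, -, rfl⟩; exact tvNorm_nonneg ν)

theorem BNnorm_fMu_le (ν : SignedMeasure (Params m D)) :
    BNnorm σ m D ρ (fMu σ m D ρ ν) ≤ tvNorm ν :=
  csInf_le ⟨0, by rintro _ ⟨ν, -, rfl⟩; exact tvNorm_nonneg ν⟩ ⟨ν, rfl, rfl⟩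

theorem le_BNnorm {f : (Fin (m 0) → ℝ) → Fin (m D) → ℝ} (hf : f ∈ BNset σ m D ρ) {r : ℝ}
    (h : ∀ ν, fMu σ m D ρ ν = f → r ≤ tvNorm ν) : r ≤ BNnorm σ m D ρ f := by
  obtain ⟨μ, hμ⟩ := hf
  refine le_csInf ⟨_, μ, hμ, rfl⟩ ?_
  rintro _ ⟨ν, hν, rfl⟩
  exact h ν hν

theorem le_mul_BNnorm {f : (Fin (m 0) → ℝ) → Fin (m D) → ℝ} (hf : f ∈ BNset σ m D ρ) {r C : ℝ}
    (hC : 0 ≤ C) (h : ∀ ν, fMu σ m D ρ ν = f → r ≤ C * tvNorm ν) :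
    r ≤ C * BNnorm σ m D ρ f := by
  rcases hC.eq_or_lt with rfl | hC
  · obtain ⟨μ, hμ⟩ := hf
    simpa using h μ hμ
  · rw [mul_comm, ← div_le_iff₀ hC]
    refine le_BNnorm hf fun ν hν => ?_
    rw [div_le_iff₀ hC, mul_comm]
    exact h ν hν

theorem BNnorm_add_le (hKb : ∀ x k θ, Kb x k θ = NNet σ m D θ x k * ρ θ)
    {f g : (Fin (m 0) → ℝ) → Fin (m D) → ℝ} (hf : f ∈ BNset σ m D ρ) (hg : g ∈ BNset σ m D ρ) :
    BNnorm σ m D ρ (f + g) ≤ BNnorm σ m D ρ f + BNnorm σ m D ρ g := by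
  rw [← sub_le_iff_le_add]
  refine le_BNnorm hf ?_
  rintro μ rfl
  rw [sub_le_iff_le_add, ← sub_le_iff_le_add']
  refine le_BNnorm hg ?_
  rintro ν rfl
  rw [sub_le_iff_le_add', ← fMu_add hKb]
  exact (BNnorm_fMu_le _).trans (tvNorm_add_le μ ν)

theorem BNnorm_smul_le (c : ℝ) {f : (Fin (m 0) → ℝ) → Fin (m D) → ℝ}
    (hf : f ∈ BNset σ m D ρ) : BNnorm σ m D ρ (c • f) ≤ ‖c‖ * BNnorm σ m D ρ f := by
  refine le_mul_BNnorm hf (norm_nonneg c) ?_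
  rintro ν rfl
  rw [← fMu_smul, Real.norm_eq_abs, ← tvNorm_smul]
  exact BNnorm_fMu_le _

theorem abs_apply_le_BNnorm (hKb : ∀ x k θ, Kb x k θ = NNet σ m D θ x k * ρ θ)
    {f : (Fin (m 0) → ℝ) → Fin (m D) → ℝ} (hf : f ∈ BNset σ m D ρ) (x : Fin (m 0) → ℝ)
    (k : Fin (m D)) : |f x k| ≤ ‖Kb x k‖ * BNnorm σ m D ρ f := by
  refine le_mul_BNnorm hf (norm_nonneg _) ?_
  rintro ν rfl
  rw [fMu_apply hKb]
  exact abs_sInt_le ν _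

/-- `B_N` as a linear space of functions. -/
def BNspace (hKb : ∀ x k θ, Kb x k θ = NNet σ m D θ x k * ρ θ) :
    Submodule ℝ ((Fin (m 0) → ℝ) → Fin (m D) → ℝ) where
  carrier := BNset σ m D ρ
  zero_mem' := ⟨(0 : ℝ) • 0, by rw [fMu_smul, zero_smul]⟩
  add_mem' := by
    rintro _ _ ⟨μ, rfl⟩ ⟨ν, rfl⟩
    exact ⟨μ + ν, fMu_add hKb μ ν⟩
  smul_mem' := by
    rintro c _ ⟨μ, rfl⟩
    exact ⟨c • μ, fMu_smul c μ⟩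

/-- The norm of `B_N` as a seminorm. -/
def BNseminorm (hKb : ∀ x k θ, Kb x k θ = NNet σ m D θ x k * ρ θ) :
    Seminorm ℝ (BNspace hKb) :=
  Seminorm.ofSMulLE (fun f => BNnorm σ m D ρ f)
    (le_antisymm (by simpa using BNnorm_smul_le 0 (BNspace hKb).zero_mem) (BNnorm_nonneg _))
    (fun f g => BNnorm_add_le hKb f.2 g.2) (fun c f => BNnorm_smul_le c f.2)

theorem BNseminorm_apply (hKb : ∀ x k θ, Kb x k θ = NNet σ m D θ x k * ρ θ)
    (f : BNspace hKb) : BNseminorm hKb f = BNnorm σ m D ρ f := rfl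

theorem eq_zero_of_BNseminorm_eq_zero (hKb : ∀ x k θ, Kb x k θ = NNet σ m D θ x k * ρ θ)
    (f : BNspace hKb) (hf : BNseminorm hKb f = 0) : f = 0 := by
  ext x k
  have := abs_apply_le_BNnorm hKb f.2 x k
  rw [← BNseminorm_apply, hf, mul_zero] at this
  simpa using this

/-- The evaluation functional `f ↦ f_k(x)` on `B_N`. -/
def BNeval (hKb : ∀ x k θ, Kb x k θ = NNet σ m D θ x k * ρ θ) (x : Fin (m 0) → ℝ)
    (k : Fin (m D)) : BNspace hKb →ₗ[ℝ] ℝ where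
  toFun f := f.1 x k
  map_add' _ _ := rfl
  map_smul' _ _ := rfl

/-- The pairing of `f_μ` with a combination `g` of the kernel functions. -/
theorem sInt_combination (hKb : ∀ x k θ, Kb x k θ = NNet σ m D θ x k * ρ θ) {ι : Type*}
    [Fintype ι] (c : ι → ℝ) (X : ι → (Fin (m 0) → ℝ)) (κ : ι → Fin (m D))
    (μ : SignedMeasure (Params m D)) :
    sInt μ (∑ i, c i • Kb (X i) (κ i) : C₀(Params m D, ℝ)) =
      ∑ i, c i * fMu σ m D ρ μ (X i) (κ i) := by
  simp only [sInt_sum_smul, fMu_apply hKb]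

/-- A functional on `B_N` bounded by the norm and given by a combination of the kernel functions
comes from an element of the unit ball of `C₀`. -/
theorem norm_combination_le_one (hKb : ∀ x k θ, Kb x k θ = NNet σ m D θ x k * ρ θ) {ι : Type*}
    [Fintype ι] (c : ι → ℝ) (X : ι → (Fin (m 0) → ℝ)) (κ : ι → Fin (m D))
    (hc : ∀ f : BNspace hKb, ∑ i, c i * BNeval hKb (X i) (κ i) f ≤ BNseminorm hKb f) :
    ‖∑ i, c i • Kb (X i) (κ i)‖ ≤ 1 := by
  set g := ∑ i, c i • Kb (X i) (κ i) with hg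
  have key : ∀ μ, sInt μ g ≤ tvNorm μ := fun μ => by
    rw [hg, sInt_combination hKb]
    exact (hc ⟨fMu σ m D ρ μ, μ, rfl⟩).trans (BNnorm_fMu_le μ)
  rw [← ZeroAtInftyContinuousMap.norm_toBCF_eq_norm]
  refine (BoundedContinuousFunction.norm_le zero_le_one).2 fun θ => ?_
  change |g θ| ≤ 1
  have h1 := key (Measure.dirac θ).toSignedMeasure
  have h2 := key ((-1 : ℝ) • (Measure.dirac θ).toSignedMeasure)
  rw [sInt_smul_measure, tvNorm_smul, abs_neg, abs_one, one_mul] at h2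
  rw [sInt_toSignedMeasure_dirac] at h1 h2
  have h3 := tvNorm_toSignedMeasure_dirac_le θ
  rw [abs_le]
  constructor <;> linarith

/-- The face of the unit ball of `B_N` exposed by a combination `g` of unit norm of the kernel
functions is the subdifferential of the supremum norm at positive multiples of `g`. -/
theorem subdiffSup_smul_combination (hKb : ∀ x k θ, Kb x k θ = NNet σ m D θ x k * ρ θ)
    {ι : Type*} [Fintype ι] (c : ι → ℝ) (X : ι → (Fin (m 0) → ℝ)) (κ : ι → Fin (m D))
    (hc : ∀ f : BNspace hKb, ∑ i, c i * BNeval hKb (X i) (κ i) f ≤ BNseminorm hKb f)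
    (hg : ‖∑ i, c i • Kb (X i) (κ i)‖ = 1) {r : ℝ} (hr : 0 < r) :
    subdiffSup σ m D ρ (r • ∑ i, c i • Kb (X i) (κ i)) = (↑) ''
      {f : BNspace hKb | BNseminorm hKb f ≤ 1 ∧ ∑ i, c i * BNeval hKb (X i) (κ i) f = 1} := by
  have hpair : ∀ μ, (sInt μ (r • ∑ i, c i • Kb (X i) (κ i) : C₀(Params m D, ℝ)) =
      ‖r • ∑ i, c i • Kb (X i) (κ i)‖) ↔ ∑ i, c i * fMu σ m D ρ μ (X i) (κ i) = 1 := fun μ => by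
    simp_rw [norm_smul, hg, Finset.smul_sum, smul_smul, sInt_combination hKb, mul_assoc,
      ← Finset.mul_sum, Real.norm_of_nonneg hr.le]
    rw [mul_right_inj' hr.ne']
  ext f
  constructor
  · rintro ⟨hf, hf1, hfg⟩
    obtain ⟨μ, rfl⟩ := hf
    exact ⟨⟨_, μ, rfl⟩, ⟨hf1.le, (hpair μ).1 (hfg μ rfl)⟩, rfl⟩
  · rintro ⟨f, ⟨hf1, hfc⟩, rfl⟩
    refine ⟨f.2, le_antisymm hf1 (hfc.symm.le.trans (hc f)), fun μ hμ => (hpair μ).2 ?_⟩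
    rw [hμ]
    exact hfc

end Network

/-- The extreme points of a subset of a submodule remain extreme in the ambient module. -/
theorem Submodule.coe_mem_extremePoints_image {E : Type*} [AddCommGroup E] [Module ℝ E]
    (B : Submodule ℝ E) {A : Set B} {x : B} (hx : x ∈ A.extremePoints ℝ) :
    (x : E) ∈ (((↑) : B → E) '' A).extremePoints ℝ := by
  refine ⟨⟨x, hx.1, rfl⟩, ?_⟩
  rintro _ ⟨y, hy, rfl⟩ _ ⟨z, hz, rfl⟩ ⟨a, b, ha, hb, hab, h⟩
  rw [hx.2 hy hz ⟨a, b, ha, hb, hab, Subtype.ext h⟩]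

/-- If `λ > 0` and the loss `Q` is lower semi-continuous and convex,
then every nonzero extreme point `f̂` of the solution set `R_{X,Y}` of the
regularization problem has the form `f̂ = ∑_{ℓ=1}^{tm} γ_ℓ h_ℓ` for some nonzero
`ĝ ∈ V_N`, `∑ γ_ℓ = ‖ĝ‖_∞` and `h_ℓ ∈ ext(∂‖·‖_∞(ĝ))`. -/
theorem statement_18
    (σ : ℝ → ℝ) (hσ : Continuous σ) (m : ℕ → ℕ) (D : ℕ) (hD : 0 < D)
    (ρ : Params m D → ℝ) (hρc : Continuous ρ) (hρpos : ∀ θ, 0 < ρ θ)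
    (Kb : (Fin (m 0) → ℝ) → Fin (m D) → C₀(Params m D, ℝ))
    (hKb : ∀ x k θ, Kb x k θ = NNet σ m D θ x k * ρ θ)
    (M : ℕ) (x : Fin M → (Fin (m 0) → ℝ)) (hx : Function.Injective x)
    (Y : Fin (m D) → Fin M → ℝ) (lam : ℝ) (hlam : 0 < lam)
    (Q : (Fin (m D) → Fin M → ℝ) → ℝ) (hQ0 : ∀ z, 0 ≤ Q z)
    (hQl : LowerSemicontinuous Q) (hQc : ConvexOn ℝ Set.univ Q) :
    ∀ f ∈ Set.extremePoints ℝ (RegSolSet σ m D ρ M x Y lam Q), f ≠ 0 →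
      ∃ g : C₀(Params m D, ℝ), g ∈ VN m D Kb M x ∧ g ≠ 0 ∧
        ∃ (γ : Fin (m D * M) → ℝ)
          (h : Fin (m D * M) → ((Fin (m 0) → ℝ) → Fin (m D) → ℝ)),
          (∑ ℓ, γ ℓ) = ‖g‖
          ∧ (∀ ℓ, h ℓ ∈ Set.extremePoints ℝ (subdiffSup σ m D ρ g))
          ∧ ∀ (x' : Fin (m 0) → ℝ) (k : Fin (m D)), f x' k = ∑ ℓ, γ ℓ * h ℓ x' k := by
  intro f hf hf0
  let e := (finProdFinEquiv (m := m D) (n := M)).symm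
  let X : Fin (m D * M) → (Fin (m 0) → ℝ) := fun i => x (e i).2
  let κ : Fin (m D * M) → Fin (m D) := fun i => (e i).1
  let F : BNspace hKb := ⟨f, hf.1.1⟩
  have hF0 : F ≠ 0 := fun h => hf0 (congrArg Subtype.val h)
  have hsample : ∀ v : BNspace hKb, (∀ i, BNeval hKb (X i) (κ i) v = BNeval hKb (X i) (κ i) F) →
      (fun k j => v.1 (x j) k) = fun k j => f (x j) k := fun v hv => by
    ext k j
    have := hv (e.symm (k, j))
    simpa [X, κ, BNeval, F] using this
  have hmin : ∀ v : BNspace hKb,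
      (∀ i, BNeval hKb (X i) (κ i) v = BNeval hKb (X i) (κ i) F) →
      BNseminorm hKb F ≤ BNseminorm hKb v := fun v hv => by
    obtain ⟨μ, hμ⟩ := v.2
    have := hf.1.2 μ
    rw [hμ, regObj, regObj, hsample v hv, add_le_add_iff_left] at this
    exact le_of_mul_le_mul_left this hlam
  have hext : F ∈ ({v | BNseminorm hKb v ≤ BNseminorm hKb F ∧
      ∀ i, BNeval hKb (X i) (κ i) v = BNeval hKb (X i) (κ i) F}).extremePoints ℝ := by
    have hsol : ∀ v : BNspace hKb, BNseminorm hKb v ≤ BNseminorm hKb F →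
        (∀ i, BNeval hKb (X i) (κ i) v = BNeval hKb (X i) (κ i) F) →
        v.1 ∈ RegSolSet σ m D ρ M x Y lam Q := fun v hv hvs => by
      refine ⟨v.2, fun μ => le_trans ?_ (hf.1.2 μ)⟩
      rw [regObj, regObj, hsample v hvs, add_le_add_iff_left]
      exact mul_le_mul_of_nonneg_left hv hlam.le
    refine ⟨⟨le_rfl, fun _ => rfl⟩, ?_⟩
    rintro v ⟨hv, hvs⟩ w ⟨hw, hws⟩ ⟨a, b, ha, hb, hab, h⟩
    exact Subtype.ext (hf.2 (hsol v hv hvs) (hsol w hw hws)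
      ⟨a, b, ha, hb, hab, congrArg Subtype.val h⟩)
  obtain ⟨c, hc, hcF, γ, h, hγ, hh, hsum⟩ :=
    (BNseminorm hKb).exists_combination_of_minimal_extreme (eq_zero_of_BNseminorm_eq_zero hKb)
      (fun i => BNeval hKb (X i) (κ i)) hF0 hmin hext
  have hr : 0 < BNseminorm hKb F :=
    (apply_nonneg _ _).lt_of_ne fun h0 => hF0 (eq_zero_of_BNseminorm_eq_zero hKb F h0.symm)
  have hg : ‖∑ i, c i • Kb (X i) (κ i)‖ = 1 := by
    refine le_antisymm (norm_combination_le_one hKb c X κ hc) ?_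
    have : BNseminorm hKb F ≤ ‖∑ i, c i • Kb (X i) (κ i)‖ * BNseminorm hKb F := by
      refine le_mul_BNnorm F.2 (norm_nonneg _) fun ν hν => ?_
      refine le_trans (le_of_eq ?_) ((le_abs_self _).trans (abs_sInt_le ν _))
      rw [sInt_combination hKb, hν]
      exact hcF.symm
    exact le_of_mul_le_mul_right (by rwa [one_mul]) hr
  have hgnorm : ‖BNseminorm hKb F • ∑ i, c i • Kb (X i) (κ i)‖ = BNseminorm hKb F := by
    rw [norm_smul, hg, mul_one, Real.norm_of_nonneg hr.le]
  refine ⟨BNseminorm hKb F • ∑ i, c i • Kb (X i) (κ i), ?_, ?_, γ, fun i => h i, ?_, ?_, ?_⟩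
  · exact Submodule.smul_mem _ _ (Submodule.sum_mem _ fun i _ =>
      Submodule.smul_mem _ _ (Submodule.subset_span ⟨e i, rfl⟩))
  · rw [← norm_pos_iff, hgnorm]
    exact hr
  · rw [hγ, hgnorm]
  · intro i
    rw [subdiffSup_smul_combination hKb c X κ hc hg hr]
    exact Submodule.coe_mem_extremePoints_image _ (hh i)
  · intro x' k
    have := congrArg (BNeval hKb x' k) hsum
    simp only [map_sum, map_smul, smul_eq_mul] at this
    exact this

end
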